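/- arXiv:2507.22386 — 6 statements merged into one kernel-verified Lean document; each statement's English description precedes it below -/
import Mathlib

section
/- Let A, B, C, D be four subsets of [n] such that |A| = |B| and |C| = |D|. Then, in the group algebra k[S_n], the product of rectangular rook sums satisfies ∇_{D,C} · ∇_{B,A} = ω_{B,C} · ∑_{w ∈ S_n, |w(A) ∩ D| = |B ∩ C|} w. -/
open Finset

/-- The rectangular rook sum `∇_{B,A} = ∑_{w ∈ S_n, w(A) = B} w` in the group
algebra `k[S_n]`. -/
noncomputable def rookSum (k : Type*) [CommRing k] {n : ℕ} (B A : Finset (Fin n)) :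
    MonoidAlgebra k (Equiv.Perm (Fin n)) :=
  ∑ w ∈ Finset.univ.filter (fun w : Equiv.Perm (Fin n) => A.image ⇑w = B),
    MonoidAlgebra.of k (Equiv.Perm (Fin n)) w

/-- The integer `ω_{B,C} = |B∩C|! ⬝ |B∖C|! ⬝ |C∖B|! ⬝ |[n]∖(B∪C)|!`. -/
def omegaBC {n : ℕ} (B C : Finset (Fin n)) : ℕ :=
  (B ∩ C).card.factorial * (B \ C).card.factorial * (C \ B).card.factorial *
    ((B ∪ C)ᶜ).card.factorial

/-- The number of permutations carrying a coloring `g` to a coloring `f` whose fibers have the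
same sizes is the product of the factorials of the fiber sizes. -/
theorem card_perm_comp_eq {α ι : Type*} [Fintype α] [DecidableEq α] [Fintype ι] [DecidableEq ι]
    (f g : α → ι)
    (h : ∀ i, (univ.filter fun a => f a = i).card = (univ.filter fun a => g a = i).card) :
    (univ.filter fun u : Equiv.Perm α => g ∘ u = f).card =
      ∏ i, (univ.filter fun a => f a = i).card.factorial := by
  have e : ∀ i, Nonempty ({a // f a = i} ≃ {a // g a = i}) := fun i =>
    ⟨Fintype.equivOfCardEq (by simpa only [Fintype.card_subtype] using h i)⟩
  let u₀ : Equiv.Perm α := Equiv.ofFiberEquiv fun i => (e i).some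
  have hu₀ : ∀ a, g (u₀ a) = f a := Equiv.ofFiberEquiv_map _
  have hcard := DomMulAct.stabilizer_card f
  simp only [Fintype.card_subtype] at hcard
  rw [← hcard]
  refine card_equiv (Equiv.mulLeft u₀⁻¹) fun u => ?_
  have hinv : ∀ a, f (u₀.symm a) = g a := fun a => by
    rw [← hu₀, Equiv.apply_symm_apply]
  simp [funext_iff, hinv]

/-- The number of permutations mapping `B` onto `E` and `C` onto `D`. -/
theorem card_perm_image_eq_and_image_eq {n : ℕ} (B C D E : Finset (Fin n))
    (hBE : B.card = E.card) (hCD : C.card = D.card) :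
    (univ.filter fun u : Equiv.Perm (Fin n) => C.image u = D ∧ B.image u = E).card =
      if (E ∩ D).card = (B ∩ C).card then omegaBC B C else 0 := by
  split_ifs with hcard
  · let color (X Y : Finset (Fin n)) (a : Fin n) : Bool × Bool := (decide (a ∈ X), decide (a ∈ Y))
    have tt (X Y : Finset (Fin n)) : (univ.filter fun a => color X Y a = (true, true)) = X ∩ Y := by
      ext a; simp [color]
    have tf (X Y : Finset (Fin n)) :
        (univ.filter fun a => color X Y a = (true, false)) = X \ Y := by
      ext a; simp [color]
    have ft (X Y : Finset (Fin n)) :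
        (univ.filter fun a => color X Y a = (false, true)) = Y \ X := by
      ext a; simp [color, and_comm]
    have ff (X Y : Finset (Fin n)) :
        (univ.filter fun a => color X Y a = (false, false)) = (X ∪ Y)ᶜ := by
      ext a; simp [color]
    have key := card_perm_comp_eq (color B C) (color E D) (by
      have h₁ := card_sdiff_add_card_inter B C
      have h₂ := card_sdiff_add_card_inter E D
      have h₃ := card_sdiff_add_card_inter C B
      have h₄ := card_sdiff_add_card_inter D E
      have h₅ := card_union_add_card_inter B C
      have h₆ := card_union_add_card_inter E D
      rw [inter_comm] at h₃ h₄
      rintro ⟨_ | _, _ | _⟩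
      · rw [ff, ff, card_compl, card_compl]; congr 1; omega
      · rw [ft, ft]; omega
      · rw [tf, tf]; omega
      · rw [tt, tt]; omega)
    have image_eq_iff (X Y : Finset (Fin n)) (hXY : X.card = Y.card) (u : Equiv.Perm (Fin n)) :
        X.image u = Y ↔ ∀ a, u a ∈ Y ↔ a ∈ X := by
      constructor
      · rintro rfl a; simp
      · intro h
        refine eq_of_subset_of_card_le (fun b hb => ?_) ?_
        · obtain ⟨a, ha, rfl⟩ := mem_image.1 hb
          exact (h a).2 ha
        · rw [card_image_of_injective _ u.injective, hXY]
    have hset : (univ.filter fun u : Equiv.Perm (Fin n) => C.image u = D ∧ B.image u = E) =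
        univ.filter fun u : Equiv.Perm (Fin n) => color E D ∘ u = color B C := by
      ext u
      simp [image_eq_iff _ _ hBE, image_eq_iff _ _ hCD, funext_iff, color, forall_and, and_comm]
    rw [hset, key, Fintype.prod_prod_type]
    simp only [Fintype.prod_bool, tt, tf, ft, ff, omegaBC]
    ring
  · rw [card_eq_zero, filter_eq_empty_iff]
    rintro u - ⟨rfl, rfl⟩
    exact hcard (by rw [← image_inter _ _ u.injective, card_image_of_injective _ u.injective])

/-- Theorem (product rule, form (a)):
`∇_{D,C} ∇_{B,A} = ω_{B,C} ∑_{w ∈ S_n, |w(A) ∩ D| = |B ∩ C|} w`. -/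
theorem rookSum_mul_rookSum {n : ℕ} (k : Type*) [CommRing k]
    (A B C D : Finset (Fin n)) (hAB : A.card = B.card) (hCD : C.card = D.card) :
    rookSum k D C * rookSum k B A =
      (omegaBC B C : k) •
        ∑ w ∈ Finset.univ.filter
          (fun w : Equiv.Perm (Fin n) => (A.image ⇑w ∩ D).card = (B ∩ C).card),
          MonoidAlgebra.of k (Equiv.Perm (Fin n)) w := by
  have image_iff (u w : Equiv.Perm (Fin n)) :
      A.image ⇑(u⁻¹ * w) = B ↔ B.image ⇑u = A.image ⇑w := by
    rw [← (image_injective u.injective).eq_iff, image_image, eq_comm]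
    have : ⇑u ∘ ⇑(u⁻¹ * w) = w := by ext; simp
    rw [this]
  calc rookSum k D C * rookSum k B A
      = ∑ u : Equiv.Perm (Fin n), ∑ w : Equiv.Perm (Fin n),
          if C.image ⇑u = D ∧ B.image ⇑u = A.image ⇑w then
            MonoidAlgebra.of k (Equiv.Perm (Fin n)) w else 0 := by
        rw [rookSum, rookSum, sum_mul_sum, sum_filter]
        refine sum_congr rfl fun u _ => ?_
        split_ifs with hu
        · rw [sum_filter, ← Equiv.sum_comp (Equiv.mulLeft u⁻¹)]
          refine sum_congr rfl fun w _ => ?_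
          simp only [Equiv.coe_mulLeft, image_iff, hu, true_and, ← map_mul, mul_inv_cancel_left]
        · simp [hu]
    _ = _ := by
        rw [sum_comm, smul_sum, sum_filter]
        refine sum_congr rfl fun w _ => ?_
        rw [← sum_filter, sum_const, card_perm_image_eq_and_image_eq B C D (A.image w)
          (by rw [card_image_of_injective _ w.injective, hAB]) hCD]
        split_ifs
        · rw [Nat.cast_smul_eq_nsmul]
        · rw [zero_smul]
end

section
/- Let A, B, C, D be four subsets of [n] such that |A| = |B| and |C| = |D|. Then, in the group algebra k[S_n], we have ∇_{D,C} · ∇_{B,A} = ω_{B,C} · ∑_{U ⊆ D, V ⊆ A, |U| = |V|} (−1)^{|U| − |B∩C|} · binom(|U|, |B∩C|) · ∇_{U,V}. -/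
open Finset

theorem alternating_sum_powerset_choose {α : Type*} (s : Finset α) (r : ℕ) :
    ∑ t ∈ s.powerset, ((((-1 : ℤˣ) ^ ((t.card : ℤ) - (r : ℤ)) : ℤˣ) : ℤ) * (t.card.choose r : ℤ)) =
      if s.card = r then 1 else 0 := by
  rw [Finset.sum_powerset_apply_card
    (fun j => (((-1 : ℤˣ) ^ ((j : ℤ) - (r : ℤ)) : ℤˣ) : ℤ) * (j.choose r : ℤ))]
  rcases lt_or_ge s.card r with h | h
  · rw [if_neg h.ne]
    refine Finset.sum_eq_zero fun j hj => ?_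
    rw [Finset.mem_range] at hj
    simp [Nat.choose_eq_zero_of_lt (show j < r by omega)]
  · obtain ⟨d, hd⟩ := Nat.exists_eq_add_of_le h
    rw [hd, add_assoc, Finset.sum_range_add, Finset.sum_eq_zero, zero_add]
    · have key : ∀ i ∈ Finset.range (d + 1),
          (r + d).choose (r + i) • ((((-1 : ℤˣ) ^ (((r + i : ℕ) : ℤ) - (r : ℤ)) : ℤˣ) : ℤ) *
            ((r + i).choose r : ℤ)) = ((r + d).choose r : ℤ) * ((-1) ^ i * (d.choose i : ℤ)) := by
        intro i hi
        have hc := Nat.choose_mul (n := r + d) (k := r + i) (s := r) (by omega)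
        simp only [Nat.add_sub_cancel_left] at hc
        have hc' : ((r + d).choose (r + i) : ℤ) * ((r + i).choose r : ℤ) =
          ((r + d).choose r : ℤ) * (d.choose i : ℤ) := by exact_mod_cast hc
        have he : ((r + i : ℕ) : ℤ) - (r : ℤ) = (i : ℤ) := by push_cast; ring
        rw [he, zpow_natCast, nsmul_eq_mul]
        push_cast
        linear_combination (-1) ^ i * hc'
      rw [Finset.sum_congr rfl key, ← Finset.mul_sum, Int.alternating_sum_range_choose]
      rcases Nat.eq_zero_or_pos d with rfl | hpos
      · simp
      · rw [if_neg hpos.ne', if_neg (by omega), mul_zero]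
    · intro j hj
      rw [Finset.mem_range] at hj
      simp [Nat.choose_eq_zero_of_lt hj]

theorem card_filter_image_eq_image_eq {n : ℕ} (A B C E : Finset (Fin n)) (hAB : A.card = B.card)
    (hEC : E.card = C.card) :
    (univ.filter fun v : Equiv.Perm (Fin n) => A.image ⇑v = B ∧ E.image ⇑v = C).card =
      if (A ∩ E).card = (B ∩ C).card then omegaBC B C else 0 := by
  split_ifs with h
  · let f : Fin n → Bool × Bool := fun x => (decide (x ∈ A), decide (x ∈ E))
    let g : Fin n → Bool × Bool := fun x => (decide (x ∈ B), decide (x ∈ C))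
    have image_eq_iff : ∀ (S T : Finset (Fin n)) (v : Equiv.Perm (Fin n)),
        S.image ⇑v = T ↔ ∀ x, v x ∈ T ↔ x ∈ S := by
      intro S T v
      constructor
      · rintro rfl x
        simp
      · intro hx
        ext y
        obtain ⟨x, rfl⟩ := v.surjective y
        simp [hx]
    have mem_iff : ∀ v : Equiv.Perm (Fin n),
        (A.image ⇑v = B ∧ E.image ⇑v = C) ↔ g ∘ v = f := by
      intro v
      rw [image_eq_iff, image_eq_iff, funext_iff, ← forall_and]
      simp [f, g]
    have fiber : ∀ (S T : Finset (Fin n)) (c : Bool × Bool),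
        Fintype.card {x // (decide (x ∈ S), decide (x ∈ T)) = c} =
          match c with
          | (true, true) => (S ∩ T).card
          | (true, false) => (S \ T).card
          | (false, true) => (T \ S).card
          | (false, false) => ((S ∪ T)ᶜ).card := by
      rintro S T ⟨_ | _, _ | _⟩ <;> rw [Fintype.card_subtype] <;> congr 1 <;> ext x <;>
        simp [and_comm]
    have hfg : ∀ c, Fintype.card {x // f x = c} = Fintype.card {x // g x = c} := by
      have h1 := Finset.card_sdiff_add_card_inter A E
      have h2 := Finset.card_sdiff_add_card_inter B C
      have h3 := Finset.card_sdiff_add_card_inter E A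
      have h4 := Finset.card_sdiff_add_card_inter C B
      have h5 := Finset.card_union_add_card_inter A E
      have h6 := Finset.card_union_add_card_inter B C
      rw [Finset.inter_comm] at h3 h4
      intro c
      rw [fiber A E c, fiber B C c]
      rcases c with ⟨_ | _, _ | _⟩ <;> simp only [Finset.card_compl] <;> omega
    let v₀ : Equiv.Perm (Fin n) := Equiv.ofFiberEquiv fun c => Fintype.equivOfCardEq (hfg c)
    have hv₀ : g ∘ v₀ = f := funext fun x => Equiv.ofFiberEquiv_map _ x
    have hstab := DomMulAct.stabilizer_card g
    rw [Fintype.card_subtype] at hstab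
    have homega : ∏ c, (Fintype.card {x // g x = c}).factorial = omegaBC B C := by
      simp only [g, fiber B C]
      rw [Fintype.prod_prod_type]
      simp [omegaBC]
      ring
    rw [← homega, ← hstab]
    refine Finset.card_bij' (fun v _ => v * v₀⁻¹) (fun v _ => v * v₀) ?_ ?_ ?_ ?_
    · intro v hv
      simp only [mem_filter, mem_univ, true_and, mem_iff] at hv ⊢
      rw [Equiv.Perm.coe_mul, ← Function.comp_assoc, hv, ← hv₀, Function.comp_assoc,
        ← Equiv.Perm.coe_mul]
      simp
    · intro v hv
      simp only [mem_filter, mem_univ, true_and, mem_iff] at hv ⊢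
      rw [Equiv.Perm.coe_mul, ← Function.comp_assoc, hv, hv₀]
    · simp
    · simp
  · rw [Finset.card_eq_zero, Finset.filter_eq_empty_iff]
    rintro v - ⟨rfl, rfl⟩
    rw [← Finset.image_inter _ _ v.injective, Finset.card_image_of_injective _ v.injective] at h
    exact h rfl

theorem rookSum_mul_rookSum_eq_sum {n : ℕ} (k : Type*) [CommRing k] (A B C D : Finset (Fin n)) :
    rookSum k D C * rookSum k B A =
      ∑ w : Equiv.Perm (Fin n),
        (univ.filter fun v : Equiv.Perm (Fin n) =>
          A.image ⇑v = B ∧ (D.image ⇑w⁻¹).image ⇑v = C).card •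
            MonoidAlgebra.of k (Equiv.Perm (Fin n)) w := by
  have image_iff : ∀ w v : Equiv.Perm (Fin n),
      C.image ⇑(w * v⁻¹) = D ↔ (D.image ⇑w⁻¹).image ⇑v = C := by
    intro w v
    rw [Finset.image_image, ← Equiv.Perm.coe_mul]
    constructor
    · rintro rfl
      rw [Finset.image_image, ← Equiv.Perm.coe_mul]
      simp
    · rintro rfl
      rw [Finset.image_image, ← Equiv.Perm.coe_mul]
      simp
  unfold rookSum
  rw [Finset.sum_filter, Finset.sum_filter, Finset.sum_mul_sum, Finset.sum_comm]
  calc _ = ∑ v : Equiv.Perm (Fin n), ∑ w : Equiv.Perm (Fin n),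
        if A.image ⇑v = B ∧ (D.image ⇑w⁻¹).image ⇑v = C then
          MonoidAlgebra.of k (Equiv.Perm (Fin n)) w else 0 := by
        refine Finset.sum_congr rfl fun v _ => ?_
        rw [← Equiv.sum_comp (Equiv.mulRight v⁻¹)]
        refine Finset.sum_congr rfl fun w _ => ?_
        rw [Equiv.coe_mulRight, ite_zero_mul_ite_zero, ← map_mul, inv_mul_cancel_right]
        simp only [image_iff, and_comm]
    _ = _ := by
        rw [Finset.sum_comm]
        refine Finset.sum_congr rfl fun w _ => ?_
        rw [← Finset.sum_filter, Finset.sum_const]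

theorem sum_powerset_smul_rookSum {n : ℕ} (k : Type*) [CommRing k] (A D : Finset (Fin n))
    (c : ℕ → ℤ) :
    ∑ U ∈ D.powerset, ∑ V ∈ A.powerset.filter (fun V => U.card = V.card),
        c U.card • rookSum k U V =
      ∑ w : Equiv.Perm (Fin n), (∑ V ∈ (A ∩ D.image ⇑w⁻¹).powerset, c V.card) •
        MonoidAlgebra.of k (Equiv.Perm (Fin n)) w := by
  have image_subset_iff : ∀ (w : Equiv.Perm (Fin n)) (V : Finset (Fin n)),
      V.image ⇑w ⊆ D ↔ V ⊆ D.image ⇑w⁻¹ := by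
    intro w V
    rw [← Finset.image_subset_image_iff (w⁻¹).injective, Finset.image_image, ← Equiv.Perm.coe_mul]
    simp
  calc _ = ∑ U ∈ D.powerset, ∑ V ∈ A.powerset, ∑ w : Equiv.Perm (Fin n),
        if V.image ⇑w = U then c V.card • MonoidAlgebra.of k (Equiv.Perm (Fin n)) w else 0 := by
        refine Finset.sum_congr rfl fun U _ => ?_
        rw [Finset.sum_filter]
        refine Finset.sum_congr rfl fun V _ => ?_
        rw [← Finset.sum_filter]
        split_ifs with h
        · rw [rookSum, Finset.smul_sum, h]
        · rw [Finset.filter_false_of_mem, Finset.sum_empty]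
          rintro w - rfl
          exact h (Finset.card_image_of_injective _ w.injective)
    _ = ∑ w : Equiv.Perm (Fin n), ∑ V ∈ A.powerset, ∑ U ∈ D.powerset,
        if V.image ⇑w = U then c V.card • MonoidAlgebra.of k (Equiv.Perm (Fin n)) w else 0 := by
        rw [Finset.sum_comm, Finset.sum_comm (s := univ)]
        exact Finset.sum_congr rfl fun V _ => Finset.sum_comm
    _ = _ := by
        refine Finset.sum_congr rfl fun w _ => ?_
        rw [Finset.sum_smul]
        simp only [Finset.sum_ite_eq, Finset.mem_powerset, image_subset_iff]
        rw [← Finset.sum_filter]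
        refine Finset.sum_congr ?_ fun _ _ => rfl
        ext V
        rw [Finset.mem_filter, Finset.mem_powerset, Finset.mem_powerset, Finset.subset_inter_iff]

/-- Theorem (product rule, form (b)):
`∇_{D,C} ∇_{B,A} = ω_{B,C} ∑_{U ⊆ D, V ⊆ A, |U| = |V|}
   (−1)^{|U| − |B∩C|} binom(|U|, |B∩C|) ∇_{U,V}`.
The sign `(−1)^{|U| − |B∩C|}` is computed in the group of units `ℤˣ`
(the exponent `|U| − |B∩C|` being an integer, possibly negative). -/
theorem rookSum_mul_rookSum_expand {n : ℕ} (k : Type*) [CommRing k]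
    (A B C D : Finset (Fin n)) (hAB : A.card = B.card) (hCD : C.card = D.card) :
    rookSum k D C * rookSum k B A =
      (omegaBC B C : ℤ) •
        ∑ U ∈ D.powerset, ∑ V ∈ A.powerset.filter (fun V => U.card = V.card),
          ((((-1 : ℤˣ) ^ ((U.card : ℤ) - ((B ∩ C).card : ℤ)) : ℤˣ) : ℤ) *
            (U.card.choose ((B ∩ C).card) : ℤ)) • rookSum k U V := by
  rw [rookSum_mul_rookSum_eq_sum, sum_powerset_smul_rookSum k A D
    (fun j => (((-1 : ℤˣ) ^ ((j : ℤ) - ((B ∩ C).card : ℤ)) : ℤˣ) : ℤ) *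
      (j.choose ((B ∩ C).card) : ℤ)), Finset.smul_sum]
  refine Finset.sum_congr rfl fun w _ => ?_
  rw [card_filter_image_eq_image_eq A B C _ hAB
      ((Finset.card_image_of_injective _ (w⁻¹).injective).trans hCD.symm),
    alternating_sum_powerset_choose]
  split_ifs
  · rw [one_smul, natCast_zsmul]
  · simp
end

section
/- Let A, B, C, D be four subsets of [n] such that |A| = |B| and |C| = |D|. Then, in the group algebra k[S_n], we have ∇_{D,C} · ∇_{B,A} = ω_{B,C} · ∑_{V ⊆ A} (−1)^{|V| − |B∩C|} · binom(|V|, |B∩C|) · ∇̃_{D,V}. -/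
open Finset

/-- The rectangular rook sum `∇̃_{B,A} = ∑_{w ∈ S_n, w(A) ⊆ B} w` in the group
algebra `k[S_n]`. -/
noncomputable def rookSumTilde (k : Type*) [CommRing k] {n : ℕ} (B A : Finset (Fin n)) :
    MonoidAlgebra k (Equiv.Perm (Fin n)) :=
  ∑ w ∈ Finset.univ.filter (fun w : Equiv.Perm (Fin n) => A.image ⇑w ⊆ B),
    MonoidAlgebra.of k (Equiv.Perm (Fin n)) w

theorem sum_powerset_neg_one_zpow_mul_choose {α : Type*} (S : Finset α) (m : ℕ) :
    ∑ V ∈ S.powerset,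
      ((((-1 : ℤˣ) ^ ((V.card : ℤ) - (m : ℤ)) : ℤˣ) : ℤ) * (V.card.choose m : ℤ)) =
      if S.card = m then 1 else 0 := by
  rw [Finset.sum_powerset_apply_card
    (fun j => (((-1 : ℤˣ) ^ ((j : ℤ) - (m : ℤ)) : ℤˣ) : ℤ) * (j.choose m : ℤ))]
  rcases lt_or_ge S.card m with h | h
  · rw [if_neg h.ne]
    refine Finset.sum_eq_zero fun j hj => ?_
    have hjm : j < m := by rw [Finset.mem_range] at hj; omega
    rw [Nat.choose_eq_zero_of_lt hjm]
    simp
  · obtain ⟨t, ht⟩ := Nat.exists_eq_add_of_le h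
    rw [ht, add_assoc, Finset.sum_range_add, Finset.sum_eq_zero, zero_add]
    · have key : ∀ i ∈ Finset.range (t + 1),
          (m + t).choose (m + i) • ((((-1 : ℤˣ) ^ (((m + i : ℕ) : ℤ) - (m : ℤ)) : ℤˣ) : ℤ) *
            ((m + i).choose m : ℤ)) = ((m + t).choose m : ℤ) * ((-1) ^ i * (t.choose i : ℤ)) := by
        intro i hi
        have hi' := Finset.mem_range.1 hi
        have h1 := Nat.choose_mul (n := m + t) (k := m + i) (s := m) (by omega)
        simp only [Nat.add_sub_cancel_left] at h1
        have h2 : (((m + t).choose (m + i) : ℤ) * ((m + i).choose m : ℤ)) =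
          ((m + t).choose m : ℤ) * (t.choose i : ℤ) := by exact_mod_cast h1
        push_cast
        rw [add_sub_cancel_left, zpow_natCast, nsmul_eq_mul]
        push_cast
        linear_combination (-1) ^ i * h2
      rw [Finset.sum_congr rfl key, ← Finset.mul_sum, Int.alternating_sum_range_choose]
      rcases eq_or_ne t 0 with rfl | h0
      · simp
      · simp [h0]
    · intro j hj
      rw [Nat.choose_eq_zero_of_lt (Finset.mem_range.1 hj)]
      simp

/-- The colouring of `α` by membership in `S` and `T`. -/
def membershipPair {α : Type*} [DecidableEq α] (S T : Finset α) (a : α) : Bool × Bool :=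
  (decide (a ∈ S), decide (a ∈ T))

theorem card_membershipPair_fiber_prod {α : Type*} [Fintype α] [DecidableEq α]
    (B C : Finset α) :
    ∏ i, (Fintype.card {a // membershipPair B C a = i}).factorial =
      (B ∩ C).card.factorial * (B \ C).card.factorial * (C \ B).card.factorial *
        ((B ∪ C)ᶜ).card.factorial := by
  have h11 : Fintype.card {a // membershipPair B C a = (true, true)} = (B ∩ C).card := by
    rw [Fintype.card_subtype]; congr 1; ext a; simp [membershipPair]
  have h10 : Fintype.card {a // membershipPair B C a = (true, false)} = (B \ C).card := by
    rw [Fintype.card_subtype]; congr 1; ext a; simp [membershipPair]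
  have h01 : Fintype.card {a // membershipPair B C a = (false, true)} = (C \ B).card := by
    rw [Fintype.card_subtype]; congr 1; ext a; simp [membershipPair, and_comm]
  have h00 : Fintype.card {a // membershipPair B C a = (false, false)} = ((B ∪ C)ᶜ).card := by
    rw [Fintype.card_subtype]; congr 1; ext a; simp [membershipPair]
  rw [Fintype.prod_prod_type]
  simp only [Fintype.prod_bool, h11, h10, h01, h00]
  ring

theorem image_perm_eq_iff {α : Type*} [DecidableEq α] (v : Equiv.Perm α) (S T : Finset α) :
    S.image v = T ↔ ∀ a, v a ∈ T ↔ a ∈ S := by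
  constructor
  · rintro rfl a
    simp
  · intro h
    ext b
    obtain ⟨a, rfl⟩ := v.surjective b
    simp [h]

theorem membershipPair_comp_perm_iff {α : Type*} [DecidableEq α] (v : Equiv.Perm α)
    (A E B C : Finset α) :
    membershipPair B C ∘ v = membershipPair A E ↔ A.image v = B ∧ E.image v = C := by
  rw [image_perm_eq_iff, image_perm_eq_iff, funext_iff, ← forall_and]
  simp [membershipPair]

theorem exists_perm_image_eq_of_card {α : Type*} [Fintype α] [DecidableEq α]
    {A B C E : Finset α} (hA : A.card = B.card) (hE : E.card = C.card)
    (h : (A ∩ E).card = (B ∩ C).card) :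
    ∃ v : Equiv.Perm α, A.image v = B ∧ E.image v = C := by
  have hfib : ∀ i, Fintype.card {a // membershipPair A E a = i} =
      Fintype.card {a // membershipPair B C a = i} := by
    have h10 : (A \ E).card = (B \ C).card := by
      have := Finset.card_sdiff_add_card_inter A E
      have := Finset.card_sdiff_add_card_inter B C
      omega
    have h01 : (E \ A).card = (C \ B).card := by
      have := Finset.card_sdiff_add_card_inter E A
      have := Finset.card_sdiff_add_card_inter C B
      simp only [Finset.inter_comm E A, Finset.inter_comm C B] at *
      omega
    have h00 : ((A ∪ E)ᶜ).card = ((B ∪ C)ᶜ).card := by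
      have := Finset.card_union_add_card_inter A E
      have := Finset.card_union_add_card_inter B C
      rw [Finset.card_compl, Finset.card_compl]
      omega
    rintro ⟨_ | _, _ | _⟩ <;> rw [Fintype.card_subtype, Fintype.card_subtype]
    · convert h00 using 2 <;> ext a <;> simp [membershipPair]
    · convert h01 using 2 <;> ext a <;> simp [membershipPair, and_comm]
    · convert h10 using 2 <;> ext a <;> simp [membershipPair]
    · convert h using 2 <;> ext a <;> simp [membershipPair]
  refine ⟨Equiv.ofFiberEquiv fun i => Fintype.equivOfCardEq (hfib i), ?_⟩
  rw [← membershipPair_comp_perm_iff]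
  funext a
  exact Equiv.ofFiberEquiv_map _ a

theorem card_perm_image_eq {α : Type*} [Fintype α] [DecidableEq α]
    {A B C E : Finset α} (hA : A.card = B.card) (hE : E.card = C.card) :
    (Finset.univ.filter fun v : Equiv.Perm α => A.image v = B ∧ E.image v = C).card =
      if (A ∩ E).card = (B ∩ C).card then
        (B ∩ C).card.factorial * (B \ C).card.factorial * (C \ B).card.factorial *
          ((B ∪ C)ᶜ).card.factorial
      else 0 := by
  split_ifs with h
  · obtain ⟨v₀, h₀⟩ := exists_perm_image_eq_of_card hA hE h
    rw [← card_membershipPair_fiber_prod, ← DomMulAct.stabilizer_card, Fintype.card_subtype]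
    rw [← membershipPair_comp_perm_iff] at h₀
    refine Finset.card_equiv (Equiv.mulRight v₀⁻¹) fun v => ?_
    simp only [Finset.mem_filter, Finset.mem_univ, true_and, ← membershipPair_comp_perm_iff, ← h₀]
    constructor
    · intro hv
      funext a
      simpa using congrFun hv (v₀⁻¹ a)
    · intro hv
      funext a
      simpa using congrFun hv (v₀ a)
  · rw [Finset.card_eq_zero, Finset.filter_eq_empty_iff]
    rintro v - ⟨rfl, rfl⟩
    rw [← Finset.image_inter _ _ v.injective, Finset.card_image_of_injective _ v.injective] at h
    exact h rfl

theorem rookSum_mul_rookSum_eq_sum_card {n : ℕ} (k : Type*) [CommRing k]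
    (A B C D : Finset (Fin n)) :
    rookSum k D C * rookSum k B A =
      ∑ w : Equiv.Perm (Fin n),
        ((Finset.univ.filter fun v : Equiv.Perm (Fin n) =>
          A.image v = B ∧ (D.image ⇑w⁻¹).image v = C).card : ℤ) •
          MonoidAlgebra.of k (Equiv.Perm (Fin n)) w := by
  have hcond : ∀ v w : Equiv.Perm (Fin n),
      C.image ⇑(w * v⁻¹) = D ↔ (D.image ⇑w⁻¹).image v = C := by
    intro v w
    have hmem : ∀ a, a ∈ D.image ⇑w⁻¹ ↔ w a ∈ D := by
      intro a
      have h := (image_perm_eq_iff w⁻¹ D _).1 rfl (w a)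
      rwa [← Equiv.Perm.mul_apply, inv_mul_cancel, Equiv.Perm.one_apply] at h
    simp only [image_perm_eq_iff, hmem]
    refine ⟨fun h a => ?_, fun h a => ?_⟩
    · simpa using (h (v a)).symm
    · simpa using (h (v⁻¹ a)).symm
  simp only [rookSum, Finset.sum_mul_sum, ← map_mul]
  rw [Finset.sum_comm, Finset.sum_filter]
  simp only [Finset.card_filter, Nat.cast_sum, Finset.sum_smul]
  rw [Finset.sum_comm]
  refine Finset.sum_congr rfl fun v _ => ?_
  split_ifs with hv
  · rw [Finset.sum_filter, ← Equiv.sum_comp (Equiv.mulRight v⁻¹)]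
    refine Finset.sum_congr rfl fun w _ => ?_
    simp only [Equiv.coe_mulRight, hcond, hv, true_and, inv_mul_cancel_right]
    split_ifs <;> simp
  · simp [hv]

/-- Theorem (product rule, form (c)):
`∇_{D,C} ∇_{B,A} = ω_{B,C} ∑_{V ⊆ A} (−1)^{|V| − |B∩C|} binom(|V|, |B∩C|) ∇̃_{D,V}`.
The sign `(−1)^{|V| − |B∩C|}` is computed in the group of units `ℤˣ`
(the exponent `|V| − |B∩C|` being an integer, possibly negative). -/
theorem rookSum_mul_rookSum_tilde {n : ℕ} (k : Type*) [CommRing k]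
    (A B C D : Finset (Fin n)) (hAB : A.card = B.card) (hCD : C.card = D.card) :
    rookSum k D C * rookSum k B A =
      (omegaBC B C : ℤ) •
        ∑ V ∈ A.powerset,
          ((((-1 : ℤˣ) ^ ((V.card : ℤ) - ((B ∩ C).card : ℤ)) : ℤˣ) : ℤ) *
            (V.card.choose ((B ∩ C).card) : ℤ)) • rookSumTilde k D V := by
  rw [rookSum_mul_rookSum_eq_sum_card]
  simp only [rookSumTilde, Finset.sum_filter, Finset.smul_sum]
  rw [Finset.sum_comm]
  refine Finset.sum_congr rfl fun w _ => ?_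
  have hE : (D.image ⇑w⁻¹).card = C.card := by
    rw [Finset.card_image_of_injective _ w⁻¹.injective, hCD]
  have hsub : ∀ V : Finset (Fin n), V.image w ⊆ D ↔ V ⊆ D.image ⇑w⁻¹ := by
    intro V
    rw [Finset.image_subset_iff]
    refine forall₂_congr fun a _ => ?_
    simp [Equiv.Perm.inv_def, Equiv.symm_apply_eq]
  rw [card_perm_image_eq hAB hE, ← Finset.smul_sum]
  simp only [smul_ite, smul_zero, hsub]
  rw [← Finset.sum_filter, ← Finset.sum_smul]
  have hfil : A.powerset.filter (· ⊆ D.image ⇑w⁻¹) = (A ∩ D.image ⇑w⁻¹).powerset := by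
    ext V
    simp only [Finset.mem_filter, Finset.mem_powerset, Finset.subset_inter_iff]
  rw [hfil, sum_powerset_neg_one_zpow_mul_choose]
  split_ifs <;> simp [omegaBC]
end

section
/- Let k ∈ ℕ. Then I_k · J_k = 0 and J_k · I_k = 0 in k[S_n] (i.e., every product of an element of I_k and an element of J_k, in either order, is zero). -/
open Finset

/-- A set decomposition of `[n]` of length `m`: a tuple of `m` pairwise disjoint
subsets of `[n]` (empty blocks allowed) whose union is `[n]`. -/
def IsSetDecomp {n m : ℕ} (A : Fin m → Finset (Fin n)) : Prop :=
  (Pairwise fun i j => Disjoint (A i) (A j)) ∧ ∀ x : Fin n, ∃ i, x ∈ A i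

/-- A set composition of `[n]`: a set decomposition all of whose blocks are nonempty. -/
def IsSetComp {n m : ℕ} (A : Fin m → Finset (Fin n)) : Prop :=
  IsSetDecomp A ∧ ∀ i, (A i).Nonempty

/-- The row-to-row sum `∇_{B,A} = ∑_{w ∈ S_n, w(A_i) = B_i for all i} w` in `k[S_n]`. -/
noncomputable def rowSum (k : Type*) [CommRing k] {n m : ℕ}
    (B A : Fin m → Finset (Fin n)) : MonoidAlgebra k (Equiv.Perm (Fin n)) :=
  ∑ w ∈ Finset.univ.filter (fun w : Equiv.Perm (Fin n) => ∀ i, (A i).image ⇑w = B i),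
    MonoidAlgebra.of k (Equiv.Perm (Fin n)) w

/-- The ideal `I_k = span_k{∇_{B,A} : A, B set compositions of [n], ℓ(A) = ℓ(B) ≤ k}`. -/
noncomputable def Ik (k : Type*) [CommRing k] (n kk : ℕ) :
    Submodule k (MonoidAlgebra k (Equiv.Perm (Fin n))) :=
  Submodule.span k {x | ∃ (m : ℕ) (A B : Fin m → Finset (Fin n)),
    m ≤ kk ∧ IsSetComp A ∧ IsSetComp B ∧ x = rowSum k B A}

/-- The antisymmetrizer `∇_U^- = ∑_{w ∈ S_n, w(i) = i for all i ∉ U} (−1)^w w`. -/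
noncomputable def antisym (k : Type*) [CommRing k] {n : ℕ} (U : Finset (Fin n)) :
    MonoidAlgebra k (Equiv.Perm (Fin n)) :=
  ∑ w ∈ Finset.univ.filter (fun w : Equiv.Perm (Fin n) => ∀ i ∉ U, w i = i),
    ((Equiv.Perm.sign w : ℤ) : k) • MonoidAlgebra.of k (Equiv.Perm (Fin n)) w

/-- The ideal `J_k = A ⬝ span_k{∇_U^- : U ⊆ [n], |U| = k+1} ⬝ A` of `A = k[S_n]`. -/
noncomputable def Jk (k : Type*) [CommRing k] (n kk : ℕ) :
    Submodule k (MonoidAlgebra k (Equiv.Perm (Fin n))) :=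
  (⊤ : Submodule k (MonoidAlgebra k (Equiv.Perm (Fin n)))) *
    Submodule.span k {x | ∃ U : Finset (Fin n), U.card = kk + 1 ∧ x = antisym k U} *
    (⊤ : Submodule k (MonoidAlgebra k (Equiv.Perm (Fin n))))

section

variable {k : Type*} [CommRing k] {n : ℕ}

/-- Right multiplication by a permutation relabels the source of a row-to-row sum. -/
theorem rowSum_mul_of {m : ℕ} (B A : Fin m → Finset (Fin n)) (p : Equiv.Perm (Fin n)) :
    rowSum k B A * MonoidAlgebra.of k _ p = rowSum k B (fun i => (A i).image ⇑p⁻¹) := by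
  unfold rowSum
  rw [Finset.sum_mul]
  refine Finset.sum_equiv (Equiv.mulRight p) (fun w => ?_) (fun w _ => ?_)
  · simp [Finset.image_image, Function.comp_def]
  · simp [MonoidAlgebra.single_mul_single]

/-- Left multiplication by a permutation relabels the target of a row-to-row sum. -/
theorem of_mul_rowSum {m : ℕ} (B A : Fin m → Finset (Fin n)) (p : Equiv.Perm (Fin n)) :
    MonoidAlgebra.of k _ p * rowSum k B A = rowSum k (fun i => (B i).image ⇑p) A := by
  unfold rowSum
  rw [Finset.mul_sum]
  refine Finset.sum_equiv (Equiv.mulLeft p) (fun w => ?_) (fun w _ => ?_)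
  · have h : ∀ s : Finset (Fin n), s.image ⇑(p * w) = (s.image ⇑w).image ⇑p := fun s => by
      rw [Finset.image_image, Equiv.Perm.coe_mul]
    simp only [Finset.mem_filter, Finset.mem_univ, true_and, Equiv.coe_mulLeft, h,
      (Finset.image_injective p.injective).eq_iff]
  · simp [MonoidAlgebra.single_mul_single]

theorem IsSetComp.image {m : ℕ} {A : Fin m → Finset (Fin n)} (hA : IsSetComp A)
    (p : Equiv.Perm (Fin n)) : IsSetComp (fun i => (A i).image ⇑p) := by
  refine ⟨⟨fun i j hij => ?_, fun x => ?_⟩, fun i => (hA.2 i).image _⟩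
  · exact (Finset.disjoint_image p.injective).2 (hA.1.1 hij)
  · obtain ⟨i, hi⟩ := hA.1.2 (p⁻¹ x)
    exact ⟨i, Finset.mem_image.2 ⟨_, hi, by simp⟩⟩

/-- A set with more elements than there are blocks contains two elements of one block, and
swapping these preserves every block. -/
theorem IsSetDecomp.exists_swap {m : ℕ} {A : Fin m → Finset (Fin n)} (hA : IsSetDecomp A)
    {U : Finset (Fin n)} (hU : m < U.card) :
    ∃ x ∈ U, ∃ y ∈ U, x ≠ y ∧ ∀ i, (A i).image ⇑(Equiv.swap x y) = A i := by
  choose f hf using hA.2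
  obtain ⟨x, hx, y, hy, hxy, hfxy⟩ := Finset.exists_ne_map_eq_of_card_lt_of_maps_to
    (s := U) (t := Finset.univ) (f := f) (by simpa using hU) (by simp)
  have hmem : ∀ z i, z ∈ A i ↔ f z = i := fun z i =>
    ⟨fun h => by_contra fun hne => Finset.disjoint_left.1 (hA.1 hne) (hf z) h,
      fun h => h ▸ hf z⟩
  refine ⟨x, hx, y, hy, hxy, fun i => Finset.eq_of_subset_of_card_le (fun z hz => ?_) ?_⟩
  · obtain ⟨w, hw, rfl⟩ := Finset.mem_image.1 hz
    rw [hmem] at hw ⊢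
    rw [← hw, Equiv.swap_apply_def]
    split_ifs <;> simp_all
  · rw [Finset.card_image_of_injective _ (Equiv.injective _)]

/-- An element fixed by right multiplication by a transposition in `S_U` is annihilated by the
antisymmetrizer of `U` on the right. -/
theorem mul_antisym_eq_zero {a : MonoidAlgebra k (Equiv.Perm (Fin n))} {U : Finset (Fin n)}
    {x y : Fin n} (hx : x ∈ U) (hy : y ∈ U) (hxy : x ≠ y)
    (ha : a * MonoidAlgebra.of k _ (Equiv.swap x y) = a) : a * antisym k U = 0 := by
  unfold antisym
  rw [Finset.mul_sum]
  refine Finset.sum_involution (fun w _ => Equiv.swap x y * w) (fun w _ => ?_)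
    (fun w _ _ h => ?_) (fun w hw => ?_) (fun w _ => ?_)
  · rw [map_mul, map_mul, mul_smul_comm, mul_smul_comm, ← mul_assoc, ha, ← add_smul]
    simp [Equiv.Perm.sign_swap hxy]
  · exact hxy (Equiv.swap_eq_one_iff.1 (mul_eq_right.1 h))
  · simp only [Finset.mem_filter, Finset.mem_univ, true_and] at hw ⊢
    intro i hi
    rw [Equiv.Perm.mul_apply, hw i hi]
    exact Equiv.swap_apply_of_ne_of_ne (fun h => hi (h ▸ hx)) (fun h => hi (h ▸ hy))
  · simp

/-- An element fixed by left multiplication by a transposition in `S_U` is annihilated by the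
antisymmetrizer of `U` on the left. -/
theorem antisym_mul_eq_zero {a : MonoidAlgebra k (Equiv.Perm (Fin n))} {U : Finset (Fin n)}
    {x y : Fin n} (hx : x ∈ U) (hy : y ∈ U) (hxy : x ≠ y)
    (ha : MonoidAlgebra.of k _ (Equiv.swap x y) * a = a) : antisym k U * a = 0 := by
  unfold antisym
  rw [Finset.sum_mul]
  refine Finset.sum_involution (fun w _ => w * Equiv.swap x y) (fun w _ => ?_)
    (fun w _ _ h => ?_) (fun w hw => ?_) (fun w _ => ?_)
  · rw [map_mul, map_mul, smul_mul_assoc, smul_mul_assoc, mul_assoc, ha, ← add_smul]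
    simp [Equiv.Perm.sign_swap hxy]
  · exact hxy (Equiv.swap_eq_one_iff.1 (mul_eq_left.1 h))
  · simp only [Finset.mem_filter, Finset.mem_univ, true_and] at hw ⊢
    intro i hi
    have hs : Equiv.swap x y i = i :=
      Equiv.swap_apply_of_ne_of_ne (fun h => hi (h ▸ hx)) (fun h => hi (h ▸ hy))
    rw [Equiv.Perm.mul_apply, hs, hw i hi]
  · simp [mul_assoc]

theorem span_range_of_eq_top (k G : Type*) [CommRing k] [Monoid G] :
    Submodule.span k (Set.range (MonoidAlgebra.of k G)) = ⊤ := by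
  refine eq_top_iff.2 fun f _ => ?_
  induction f using MonoidAlgebra.induction_on with
  | of g => exact Submodule.subset_span ⟨g, rfl⟩
  | add f g hf hg => exact Submodule.add_mem _ (hf trivial) (hg trivial)
  | smul r f hf => exact Submodule.smul_mem _ r (hf trivial)

theorem Ik_mul_top_le (kk : ℕ) : Ik k n kk * ⊤ ≤ Ik k n kk := by
  rw [← span_range_of_eq_top, Ik, Submodule.span_mul_span, Submodule.span_le]
  rintro _ ⟨_, ⟨m, A, B, hm, hA, hB, rfl⟩, _, ⟨p, rfl⟩, rfl⟩
  exact Submodule.subset_span ⟨m, _, _, hm, hA.image p⁻¹, hB, rowSum_mul_of B A p⟩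

theorem top_mul_Ik_le (kk : ℕ) : ⊤ * Ik k n kk ≤ Ik k n kk := by
  rw [← span_range_of_eq_top, Ik, Submodule.span_mul_span, Submodule.span_le]
  rintro _ ⟨_, ⟨p, rfl⟩, _, ⟨m, A, B, hm, hA, hB, rfl⟩, rfl⟩
  exact Submodule.subset_span ⟨m, _, _, hm, hA, hB.image p, of_mul_rowSum B A p⟩

theorem Ik_mul_span_antisym (kk : ℕ) :
    Ik k n kk * Submodule.span k {x | ∃ U : Finset (Fin n), U.card = kk + 1 ∧ x = antisym k U}
      = ⊥ := by
  rw [Ik, Submodule.span_mul_span, Submodule.span_eq_bot]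
  rintro _ ⟨_, ⟨m, A, B, hm, hA, -, rfl⟩, _, ⟨U, hU, rfl⟩, rfl⟩
  obtain ⟨x, hx, y, hy, hxy, h⟩ := hA.1.exists_swap (U := U) (by omega)
  refine mul_antisym_eq_zero hx hy hxy ?_
  simp only [rowSum_mul_of, Equiv.swap_inv, h]

theorem span_antisym_mul_Ik (kk : ℕ) :
    Submodule.span k {x | ∃ U : Finset (Fin n), U.card = kk + 1 ∧ x = antisym k U} * Ik k n kk
      = ⊥ := by
  rw [Ik, Submodule.span_mul_span, Submodule.span_eq_bot]
  rintro _ ⟨_, ⟨U, hU, rfl⟩, _, ⟨m, A, B, hm, -, hB, rfl⟩, rfl⟩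
  obtain ⟨x, hx, y, hy, hxy, h⟩ := hB.1.exists_swap (U := U) (by omega)
  refine antisym_mul_eq_zero hx hy hxy ?_
  simp only [of_mul_rowSum, h]

end

/-- Theorem: `I_k ⬝ J_k = 0` and `J_k ⬝ I_k = 0` in `k[S_n]`. -/
theorem Ik_mul_Jk_eq_bot (k : Type*) [CommRing k] (n kk : ℕ) :
    Ik k n kk * Jk k n kk = ⊥ ∧ Jk k n kk * Ik k n kk = ⊥ := by
  constructor
  · rw [Jk, ← mul_assoc, ← mul_assoc, eq_bot_iff]
    refine (mul_le_mul_left (mul_le_mul_left (Ik_mul_top_le kk) _) _).trans ?_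
    rw [Ik_mul_span_antisym, Submodule.bot_mul]
  · rw [Jk, mul_assoc, mul_assoc, eq_bot_iff]
    refine (mul_le_mul_right (mul_le_mul_right (top_mul_Ik_le kk) _) _).trans ?_
    rw [span_antisym_mul_Ik, Submodule.mul_bot]
end

section
/- Let k ∈ ℕ, let (A_1, A_2, …, A_k) be a set decomposition of [n], and let v ∈ S_n be a permutation such that each restriction v|_{A_i} is strictly decreasing. Let w ∈ S_n be a permutation such that w(A_i) = v(A_i) for all i ∈ [k]. Then w ≤ v in lexicographic order. -/
open Finset

/-- Lemma: let `(A_1,…,A_k)` be a set decomposition of `[n]`, let `v ∈ S_n` be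
strictly decreasing on each block `A_i`, and let `w ∈ S_n` satisfy
`w(A_i) = v(A_i)` for all `i`.  Then `w ≤ v` in lexicographic order, i.e.
either `w = v`, or at the first position where they differ, `w` takes the
smaller value (equivalently: there is an `i` with `w j = v j` for all `j < i`
and `w i < v i`). -/
theorem le_lex_of_blockwise {n kk : ℕ} (A : Fin kk → Finset (Fin n))
    (hA : IsSetDecomp A) (v w : Equiv.Perm (Fin n))
    (hdec : ∀ i, StrictAntiOn ⇑v ↑(A i))
    (hw : ∀ i, (A i).image ⇑w = (A i).image ⇑v) :
    w = v ∨ ∃ i : Fin n, (∀ j < i, w j = v j) ∧ w i < v i := by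
  by_cases h : ∃ i, w i ≠ v i
  · obtain ⟨i, hi, hmin⟩ := wellFounded_lt.has_min {i : Fin n | w i ≠ v i} h
    have heq : ∀ j < i, w j = v j := fun j hj => not_not.mp fun hne => hmin j hne hj
    refine Or.inr ⟨i, heq, ?_⟩
    obtain ⟨b, hb⟩ := hA.2 i
    have hmem : w i ∈ (A b).image v := hw b ▸ mem_image_of_mem w hb
    obtain ⟨q, hq, hqi⟩ := mem_image.mp hmem
    rcases lt_trichotomy q i with hlt | rfl | hgt
    · exact absurd (w.injective ((heq q hlt).trans hqi)) hlt.ne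
    · exact absurd hqi.symm hi
    · exact hqi ▸ hdec b hb hq hgt
  · push Not at h
    exact Or.inl (Equiv.ext h)
end

section
/- Let k ∈ ℕ, and assume that n! is invertible in the commutative ring k. Then A = I_k ⊕ J_k as an internal direct sum of k-modules. Moreover, the ideals I_k and J_k, viewed as nonunital subalgebras of A, each possess a (two-sided) multiplicative unity element, and the map I_k × J_k → A, (i,j) ↦ i + j, is an isomorphism of k-algebras (where I_k × J_k carries componentwise operations). -/
open Finset
open Finset

section

variable {k : Type*} [CommRing k] {n : ℕ}

local notation "𝔸" => MonoidAlgebra k (Equiv.Perm (Fin n))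

/-- The sum of the permutations carrying the colouring `a` to the colouring `b`. This is `rowSum` for
set decompositions that are described by their colourings. -/
noncomputable def colorSum (k : Type*) [CommRing k] {n : ℕ} {κ : Type*} [DecidableEq κ]
    (b a : Fin n → κ) : MonoidAlgebra k (Equiv.Perm (Fin n)) :=
  ∑ w ∈ Finset.univ.filter (fun w : Equiv.Perm (Fin n) => ∀ x, b (w x) = a x),
    MonoidAlgebra.of k (Equiv.Perm (Fin n)) w

theorem of_mul_colorSum {κ : Type*} [DecidableEq κ] (v : Equiv.Perm (Fin n)) (b a : Fin n → κ) :
    MonoidAlgebra.of k _ v * colorSum k b a = colorSum k (b ∘ ⇑v⁻¹) a := by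
  unfold colorSum
  rw [Finset.mul_sum]
  refine Finset.sum_bij' (fun w _ => v * w) (fun w _ => v⁻¹ * w) ?_ ?_ ?_ ?_ ?_ <;>
    simp

theorem colorSum_mul_of {κ : Type*} [DecidableEq κ] (v : Equiv.Perm (Fin n)) (b a : Fin n → κ) :
    colorSum k b a * MonoidAlgebra.of k _ v = colorSum k b (a ∘ ⇑v) := by
  unfold colorSum
  rw [Finset.sum_mul]
  refine Finset.sum_bij' (fun w _ => w * v) (fun w _ => w * v⁻¹) ?_ ?_ ?_ ?_ ?_ <;>
    simp +contextual

theorem rowSum_eq_colorSum {m : ℕ} {κ : Type*} [DecidableEq κ] (A B : Fin m → Finset (Fin n))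
    (e : Fin m → κ) (a b : Fin n → κ)
    (ha : ∀ x i, x ∈ A i ↔ a x = e i) (hb : ∀ x i, x ∈ B i ↔ b x = e i)
    (hr : ∀ x, ∃ i, a x = e i) :
    rowSum k B A = colorSum k b a := by
  unfold rowSum colorSum
  congr 1
  ext w
  simp only [Finset.mem_filter, Finset.mem_univ, true_and]
  constructor
  · intro h x
    obtain ⟨i, hi⟩ := hr x
    rw [hi, ← hb, ← h i]
    exact Finset.mem_image_of_mem _ ((ha x i).2 hi)
  · intro h i
    ext y
    obtain ⟨x, rfl⟩ := w.surjective y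
    simp [hb, ha, h]

theorem colorSum_mem_Ik {kk : ℕ} (b a : Fin n → Fin kk) : colorSum k b a ∈ Ik k n kk := by
  classical
  by_cases hw : ∃ w : Equiv.Perm (Fin n), ∀ x, b (w x) = a x
  · obtain ⟨w, hw⟩ := hw
    set S := Finset.univ.image a with hS
    have hSb : ∀ y, b y ∈ S := fun y => by
      obtain ⟨x, rfl⟩ := w.surjective y
      rw [hw]; exact Finset.mem_image_of_mem _ (Finset.mem_univ _)
    let e := S.orderEmbOfFin rfl
    have hr : ∀ s ∈ S, ∃ i, s = e i := fun s hs => by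
      have : s ∈ Set.range e := by rw [Finset.range_orderEmbOfFin]; exact hs
      obtain ⟨i, hi⟩ := this
      exact ⟨i, hi.symm⟩
    have hdec : ∀ c : Fin n → Fin kk, (∀ x, c x ∈ S) → (∀ i, ∃ x, c x = e i) →
        IsSetComp (fun i : Fin S.card => Finset.univ.filter (fun x => c x = e i)) := by
      intro c hc hc'
      refine ⟨⟨fun i j hij => ?_, fun x => ?_⟩, fun i => ?_⟩
      · refine Finset.disjoint_left.2 fun x hx hx' => ?_
        simp only [Finset.mem_filter, Finset.mem_univ, true_and] at hx hx'
        exact hij (e.injective (hx.symm.trans hx'))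
      · simpa using hr _ (hc x)
      · obtain ⟨x, hx⟩ := hc' i
        exact ⟨x, by simpa using hx⟩
    have hea : ∀ i, ∃ x, a x = e i := fun i => by
      have : e i ∈ Finset.univ.image a := S.orderEmbOfFin_mem rfl i
      simpa only [Finset.mem_image, Finset.mem_univ, true_and] using this
    refine Submodule.subset_span ⟨S.card, _, _, ?_, hdec a (fun x => by simp [hS]) hea,
      hdec b hSb (fun i => ?_), ?_⟩
    · simpa using S.card_le_univ
    · obtain ⟨x, hx⟩ := hea i
      exact ⟨w x, by rw [hw, hx]⟩
    · symm
      exact rowSum_eq_colorSum _ _ e a b (by simp) (by simp)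
        (fun x => hr _ (by simp [hS]))
  · have : colorSum k b a = 0 := by
      unfold colorSum
      rw [Finset.filter_false_of_mem, Finset.sum_empty]
      exact fun w _ h => hw ⟨w, h⟩
    rw [this]
    exact zero_mem _

theorem Ik_eq_span_colorSum (k : Type*) [CommRing k] (n kk : ℕ) :
    Ik k n kk = Submodule.span k {x | ∃ b a : Fin n → Fin kk, x = colorSum k b a} := by
  apply le_antisymm
  · rw [Ik, Submodule.span_le]
    rintro _ ⟨m, A, B, hm, hA, hB, rfl⟩
    have hcol : ∀ C : Fin m → Finset (Fin n), IsSetComp C →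
        ∃ c : Fin n → Fin m, ∀ x i, x ∈ C i ↔ c x = i := by
      intro C hC
      choose c hc using hC.1.2
      refine ⟨c, fun x i => ⟨fun h => ?_, fun h => h ▸ hc x⟩⟩
      by_contra hne
      exact Finset.disjoint_left.1 (hC.1.1 hne) (hc x) h
    obtain ⟨a, ha⟩ := hcol A hA
    obtain ⟨b, hb⟩ := hcol B hB
    have hinj := Fin.castLE_injective hm
    exact Submodule.subset_span ⟨_, _, rowSum_eq_colorSum A B (Fin.castLE hm)
      (Fin.castLE hm ∘ a) (Fin.castLE hm ∘ b) (by simp [ha, hinj.eq_iff])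
      (by simp [hb, hinj.eq_iff]) (fun x => ⟨a x, rfl⟩)⟩
  · rw [Submodule.span_le]
    rintro _ ⟨b, a, rfl⟩
    exact colorSum_mem_Ik b a

/-- A submodule of a monoid algebra that is stable under left multiplication by monoid elements is
stable under left multiplication by arbitrary elements. -/
theorem MonoidAlgebra.mul_mem_of_forall_of_mul_mem {G : Type*} [Monoid G]
    (I : Submodule k (MonoidAlgebra k G))
    (h : ∀ g, ∀ x ∈ I, MonoidAlgebra.of k G g * x ∈ I) (y : MonoidAlgebra k G)
    {x : MonoidAlgebra k G} (hx : x ∈ I) : y * x ∈ I := by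
  induction y using MonoidAlgebra.induction_on with
  | of g => exact h g x hx
  | add f g hf hg => rw [add_mul]; exact add_mem hf hg
  | smul r f hf => rw [smul_mul_assoc]; exact I.smul_mem r hf

/-- A submodule of a monoid algebra that is stable under right multiplication by monoid elements is
stable under right multiplication by arbitrary elements. -/
theorem MonoidAlgebra.mul_mem_of_forall_mul_of_mem {G : Type*} [Monoid G]
    (I : Submodule k (MonoidAlgebra k G))
    (h : ∀ g, ∀ x ∈ I, x * MonoidAlgebra.of k G g ∈ I) (y : MonoidAlgebra k G)
    {x : MonoidAlgebra k G} (hx : x ∈ I) : x * y ∈ I := by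
  induction y using MonoidAlgebra.induction_on with
  | of g => exact h g x hx
  | add f g hf hg => rw [mul_add]; exact add_mem hf hg
  | smul r f hf => rw [mul_smul_comm]; exact I.smul_mem r hf

theorem mul_mem_Ik {kk : ℕ} (y : 𝔸) {x : 𝔸} (hx : x ∈ Ik k n kk) : y * x ∈ Ik k n kk := by
  refine MonoidAlgebra.mul_mem_of_forall_of_mul_mem _ (fun g x hx => ?_) y hx
  rw [Ik_eq_span_colorSum] at hx ⊢
  induction hx using Submodule.span_induction with
  | mem x hx =>
    obtain ⟨b, a, rfl⟩ := hx
    rw [of_mul_colorSum]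
    exact Submodule.subset_span ⟨_, _, rfl⟩
  | zero => rw [mul_zero]; exact zero_mem _
  | add x y _ _ hx hy => rw [mul_add]; exact add_mem hx hy
  | smul r x _ hx => rw [mul_smul_comm]; exact Submodule.smul_mem _ r hx

theorem mem_Ik_mul {kk : ℕ} (y : 𝔸) {x : 𝔸} (hx : x ∈ Ik k n kk) : x * y ∈ Ik k n kk := by
  refine MonoidAlgebra.mul_mem_of_forall_mul_of_mem _ (fun g x hx => ?_) y hx
  rw [Ik_eq_span_colorSum] at hx ⊢
  induction hx using Submodule.span_induction with
  | mem x hx =>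
    obtain ⟨b, a, rfl⟩ := hx
    rw [colorSum_mul_of]
    exact Submodule.subset_span ⟨_, _, rfl⟩
  | zero => rw [zero_mul]; exact zero_mem _
  | add x y _ _ hx hy => rw [add_mul]; exact add_mem hx hy
  | smul r x _ hx => rw [smul_mul_assoc]; exact Submodule.smul_mem _ r hx

theorem mul_mem_Jk {kk : ℕ} (y : 𝔸) {x : 𝔸} (hx : x ∈ Jk k n kk) : y * x ∈ Jk k n kk := by
  have h := Submodule.mul_mem_mul (Submodule.mem_top (R := k) (x := y)) hx
  rw [Jk, ← mul_assoc, ← mul_assoc] at h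
  have hle : ⊤ * ⊤ ≤ (⊤ : Submodule k 𝔸) := le_top
  exact (mul_le_mul_left (mul_le_mul_left hle _) _ : _ ≤ Jk k n kk) h

theorem mem_Jk_mul {kk : ℕ} (y : 𝔸) {x : 𝔸} (hx : x ∈ Jk k n kk) : x * y ∈ Jk k n kk := by
  have h := Submodule.mul_mem_mul hx (Submodule.mem_top (R := k) (x := y))
  rw [Jk, mul_assoc] at h
  have hle : ⊤ * ⊤ ≤ (⊤ : Submodule k 𝔸) := le_top
  exact (mul_le_mul_right hle _ : _ ≤ Jk k n kk) h

theorem antisym_mem_Jk {kk : ℕ} {U : Finset (Fin n)} (hU : U.card = kk + 1) :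
    antisym k U ∈ Jk k n kk := by
  have h := Submodule.mul_mem_mul (Submodule.mul_mem_mul (Submodule.mem_top (R := k) (x := (1 : 𝔸)))
    (Submodule.subset_span (R := k)
      (show antisym k U ∈ {x : 𝔸 | ∃ U : Finset (Fin n), U.card = kk + 1 ∧ x = antisym k U} from
        ⟨U, hU, rfl⟩))) (Submodule.mem_top (R := k) (x := (1 : 𝔸)))
  rwa [one_mul, mul_one] at h

theorem of_swap_mul_antisym {U : Finset (Fin n)} {p q : Fin n} (hp : p ∈ U) (hq : q ∈ U)
    (hpq : p ≠ q) :
    MonoidAlgebra.of k _ (Equiv.swap p q) * antisym k U = -antisym k U := by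
  have hfix : ∀ i ∉ U, Equiv.swap p q i = i := fun i hi =>
    Equiv.swap_apply_of_ne_of_ne (fun h => hi (h ▸ hp)) (fun h => hi (h ▸ hq))
  unfold antisym
  rw [Finset.mul_sum, ← Finset.sum_neg_distrib]
  refine Finset.sum_bij' (fun w _ => Equiv.swap p q * w) (fun w _ => Equiv.swap p q * w)
    ?_ ?_ ?_ ?_ ?_ <;> simp +contextual [hfix, Equiv.Perm.sign_swap hpq]

theorem antisym_mul_of_swap {U : Finset (Fin n)} {p q : Fin n} (hp : p ∈ U) (hq : q ∈ U)
    (hpq : p ≠ q) :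
    antisym k U * MonoidAlgebra.of k _ (Equiv.swap p q) = -antisym k U := by
  have hfix : ∀ i ∉ U, Equiv.swap p q i = i := fun i hi =>
    Equiv.swap_apply_of_ne_of_ne (fun h => hi (h ▸ hp)) (fun h => hi (h ▸ hq))
  unfold antisym
  rw [Finset.sum_mul, ← Finset.sum_neg_distrib]
  refine Finset.sum_bij' (fun w _ => w * Equiv.swap p q) (fun w _ => w * Equiv.swap p q)
    ?_ ?_ ?_ ?_ ?_ <;> simp +contextual [hfix, Equiv.Perm.sign_swap hpq]

theorem isUnit_two_of_isUnit_factorial (h : IsUnit ((n.factorial : ℕ) : k)) (hn : 2 ≤ n) :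
    IsUnit (2 : k) := by
  have : ((2 : ℕ) : k) ∣ ((n.factorial : ℕ) : k) :=
    Nat.cast_dvd_cast (Nat.dvd_factorial two_pos hn)
  simpa using isUnit_of_dvd_unit this h

theorem eq_zero_of_eq_neg_of_isUnit_two {M : Type*} [AddCommGroup M] [Module k M]
    (h2 : IsUnit (2 : k)) {x : M} (hx : x = -x) : x = 0 := by
  rw [← h2.smul_eq_zero, two_smul]
  nth_rewrite 1 [hx]
  exact neg_add_cancel x

theorem exists_pair_of_card {kk : ℕ} {U : Finset (Fin n)} (hU : U.card = kk + 1)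
    (a : Fin n → Fin kk) : 2 ≤ n ∧ ∃ p ∈ U, ∃ q ∈ U, p ≠ q ∧ a p = a q := by
  obtain ⟨p, hp, q, hq, hpq, hapq⟩ := Finset.exists_ne_map_eq_of_card_lt_of_maps_to
    (s := U) (t := Finset.univ) (f := a) (by simp [hU]) (by simp)
  refine ⟨?_, p, hp, q, hq, hpq, hapq⟩
  have := p.isLt
  have := q.isLt
  have := Fin.val_ne_of_ne hpq
  omega

theorem comp_swap_eq {ι κ : Type*} [DecidableEq ι] {a : ι → κ} {p q : ι} (h : a p = a q) :
    a ∘ ⇑(Equiv.swap p q) = a := by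
  funext x
  simp only [Function.comp_apply, Equiv.swap_apply_def]
  split_ifs <;> simp_all

theorem colorSum_mul_antisym {kk : ℕ} (h : IsUnit ((n.factorial : ℕ) : k)) {U : Finset (Fin n)}
    (hU : U.card = kk + 1) (b a : Fin n → Fin kk) : colorSum k b a * antisym k U = 0 := by
  obtain ⟨hn, p, hp, q, hq, hpq, hapq⟩ := exists_pair_of_card hU a
  refine eq_zero_of_eq_neg_of_isUnit_two (isUnit_two_of_isUnit_factorial h hn) ?_
  conv_lhs => rw [← comp_swap_eq hapq, ← colorSum_mul_of, mul_assoc,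
    of_swap_mul_antisym hp hq hpq, mul_neg]

theorem antisym_mul_colorSum {kk : ℕ} (h : IsUnit ((n.factorial : ℕ) : k)) {U : Finset (Fin n)}
    (hU : U.card = kk + 1) (b a : Fin n → Fin kk) : antisym k U * colorSum k b a = 0 := by
  obtain ⟨hn, p, hp, q, hq, hpq, hbpq⟩ := exists_pair_of_card hU b
  refine eq_zero_of_eq_neg_of_isUnit_two (isUnit_two_of_isUnit_factorial h hn) ?_
  conv_lhs => rw [← comp_swap_eq hbpq, ← Equiv.swap_inv, ← of_mul_colorSum, ← mul_assoc,
    antisym_mul_of_swap hp hq hpq, neg_mul]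

theorem Ik_mul_antisym {kk : ℕ} (h : IsUnit ((n.factorial : ℕ) : k)) {U : Finset (Fin n)}
    (hU : U.card = kk + 1) {x : 𝔸} (hx : x ∈ Ik k n kk) : x * antisym k U = 0 := by
  rw [Ik_eq_span_colorSum] at hx
  induction hx using Submodule.span_induction with
  | mem x hx => obtain ⟨b, a, rfl⟩ := hx; exact colorSum_mul_antisym h hU b a
  | zero => rw [zero_mul]
  | add x y _ _ hx hy => rw [add_mul, hx, hy, add_zero]
  | smul r x _ hx => rw [smul_mul_assoc, hx, smul_zero]

theorem antisym_mul_Ik {kk : ℕ} (h : IsUnit ((n.factorial : ℕ) : k)) {U : Finset (Fin n)}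
    (hU : U.card = kk + 1) {x : 𝔸} (hx : x ∈ Ik k n kk) : antisym k U * x = 0 := by
  rw [Ik_eq_span_colorSum] at hx
  induction hx using Submodule.span_induction with
  | mem x hx => obtain ⟨b, a, rfl⟩ := hx; exact antisym_mul_colorSum h hU b a
  | zero => rw [mul_zero]
  | add x y _ _ hx hy => rw [mul_add, hx, hy, add_zero]
  | smul r x _ hx => rw [mul_smul_comm, hx, smul_zero]

theorem Jk_le {kk : ℕ} {N : Submodule k 𝔸}
    (h : ∀ (U : Finset (Fin n)) (y z : 𝔸), U.card = kk + 1 → y * antisym k U * z ∈ N) :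
    Jk k n kk ≤ N := by
  refine Submodule.mul_le.2 fun m hm z _ => ?_
  suffices hle : ⊤ * Submodule.span k {x : 𝔸 | ∃ U : Finset (Fin n), U.card = kk + 1 ∧
      x = antisym k U} ≤ N.comap (LinearMap.mulRight k z) from hle hm
  refine Submodule.mul_le.2 fun y _ s hs => ?_
  suffices hle : Submodule.span k {x : 𝔸 | ∃ U : Finset (Fin n), U.card = kk + 1 ∧
      x = antisym k U} ≤ (N.comap (LinearMap.mulRight k z)).comap (LinearMap.mulLeft k y)
    from hle hs
  rw [Submodule.span_le]
  rintro _ ⟨U, hU, rfl⟩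
  exact h U y z hU

theorem Ik_mul_Jk {kk : ℕ} (h : IsUnit ((n.factorial : ℕ) : k)) {x y : 𝔸}
    (hx : x ∈ Ik k n kk) (hy : y ∈ Jk k n kk) : x * y = 0 := by
  refine Jk_le (N := LinearMap.ker (LinearMap.mulLeft k x)) (fun U y z hU => ?_) hy
  rw [LinearMap.mem_ker, LinearMap.mulLeft_apply, ← mul_assoc, ← mul_assoc,
    Ik_mul_antisym h hU (mem_Ik_mul y hx), zero_mul]

theorem Jk_mul_Ik {kk : ℕ} (h : IsUnit ((n.factorial : ℕ) : k)) {x y : 𝔸}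
    (hx : x ∈ Ik k n kk) (hy : y ∈ Jk k n kk) : y * x = 0 := by
  refine Jk_le (N := LinearMap.ker (LinearMap.mulRight k x)) (fun U y z hU => ?_) hy
  rw [LinearMap.mem_ker, LinearMap.mulRight_apply, mul_assoc, mul_assoc,
    antisym_mul_Ik h hU (mul_mem_Ik z hx), mul_zero]

/-- A nontrivial permutation moves its first moved point upwards. -/
theorem Equiv.Perm.exists_first_moved {ι : Type*} [LinearOrder ι] [WellFoundedLT ι]
    {w : Equiv.Perm ι} (hw : w ≠ 1) : ∃ i, (∀ j < i, w j = j) ∧ i < w i := by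
  have hne : {i | w i ≠ i}.Nonempty := by
    by_contra h
    exact hw (Equiv.ext fun i => by
      by_contra hi
      exact h ⟨i, hi⟩)
  obtain ⟨i, hi, hmin⟩ := wellFounded_lt.has_min _ hne
  have hlow : ∀ j < i, w j = j := fun j hj => by
    by_contra h
    exact hmin j h hj
  refine ⟨i, hlow, lt_of_le_of_ne (not_lt.1 fun h => hi ?_) (Ne.symm hi)⟩
  exact w.injective (hlow _ h)

/-- `g` has no decreasing subsequence of length `kk + 1`. -/
def AvoidsDecreasing (kk : ℕ) (g : Equiv.Perm (Fin n)) : Prop :=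
  ∀ U : Finset (Fin n), U.card = kk + 1 → ¬ StrictAntiOn g U

theorem toLex_mul_lt_of_strictAntiOn {g w : Equiv.Perm (Fin n)} {U : Finset (Fin n)}
    (hg : StrictAntiOn g U) (hw : ∀ i ∉ U, w i = i) (hw1 : w ≠ 1) :
    toLex (⇑(g * w)) < toLex (⇑g) := by
  obtain ⟨i, hlow, hi⟩ := Equiv.Perm.exists_first_moved hw1
  have hiU : i ∈ U := by
    by_contra h
    exact hi.ne' (hw i h)
  have hwiU : w i ∈ U := by
    by_contra h
    exact hi.ne' (w.injective (hw _ h))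
  exact ⟨i, fun j hj => by simp [hlow j hj], hg hiU hwiU hi⟩

theorem toLex_lt_of_strictMono_on_colors {κ : Type*} {a : Fin n → κ} {g h : Equiv.Perm (Fin n)}
    (hg : ∀ x y, a x = a y → x < y → g x < g y) (hh : ∀ x, a (g⁻¹ (h x)) = a x) (hne : g ≠ h) :
    toLex (⇑g) < toLex (⇑h) := by
  have hw1 : g⁻¹ * h ≠ 1 := fun h1 => hne (inv_mul_eq_one.1 h1)
  obtain ⟨i, hlow, hi⟩ := Equiv.Perm.exists_first_moved hw1
  refine ⟨i, fun j hj => ?_, ?_⟩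
  · have := hlow j hj
    rw [Equiv.Perm.mul_apply, Equiv.Perm.inv_eq_iff_eq] at this
    exact this.symm
  · have := hg i (g⁻¹ (h i)) (hh i).symm hi
    simpa using this

/-- A permutation with no decreasing subsequence of length `kk + 1` is a union of `kk` increasing
subsequences. -/
theorem AvoidsDecreasing.exists_coloring {kk : ℕ} {g : Equiv.Perm (Fin n)}
    (hg : AvoidsDecreasing kk g) :
    ∃ a : Fin n → Fin kk, ∀ x y, a x = a y → x < y → g x < g y := by
  classical
  let C : Fin n → Finset (Finset (Fin n)) := fun x =>
    Finset.univ.filter fun U => StrictAntiOn g U ∧ x ∈ U ∧ ∀ y ∈ U, y ≤ x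
  let ht : Fin n → ℕ := fun x => (C x).sup Finset.card
  have hsingle : ∀ x, {x} ∈ C x := fun x => by simp [C]
  have hmem : ∀ x, ∃ U ∈ C x, ht x = U.card := fun x =>
    Finset.exists_mem_eq_sup _ ⟨_, hsingle x⟩ _
  have hpos : ∀ x, 0 < ht x := fun x => by
    have : ({x} : Finset (Fin n)).card ≤ ht x := Finset.le_sup (f := Finset.card) (hsingle x)
    rwa [Finset.card_singleton] at this
  have hle : ∀ x, ht x ≤ kk := fun x => by
    obtain ⟨U, hU, hc⟩ := hmem x
    rw [hc]
    by_contra hlt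
    obtain ⟨V, hVU, hV⟩ := Finset.exists_subset_card_eq (Nat.succ_le_of_lt (not_le.1 hlt))
    exact hg V hV ((Finset.mem_filter.1 hU).2.1.mono (by exact_mod_cast hVU))
  have hlt : ∀ x y, x < y → g y < g x → ht x < ht y := fun x y hxy hgxy => by
    obtain ⟨U, hU, hc⟩ := hmem x
    simp only [C, Finset.mem_filter, Finset.mem_univ, true_and] at hU
    obtain ⟨hanti, hx, hmax⟩ := hU
    have hy : y ∉ U := fun h => (hmax y h).not_gt hxy
    have hV : insert y U ∈ C y := by
      simp only [C, Finset.mem_filter, Finset.mem_univ, true_and, Finset.mem_insert_self,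
        Finset.mem_insert, forall_eq_or_imp, le_refl]
      refine ⟨?_, fun z hz => (hmax z hz).trans hxy.le⟩
      intro u hu v hv huv
      simp only [Finset.coe_insert, Set.mem_insert_iff, Finset.mem_coe] at hu hv
      rcases hu with rfl | hu <;> rcases hv with rfl | hv
      · exact absurd huv (lt_irrefl _)
      · exact absurd (huv.trans_le (hmax v hv)) hxy.not_gt
      · exact hgxy.trans_le (hanti.antitoneOn hu hx (hmax u hu))
      · exact hanti hu hv huv
    have : (insert y U).card ≤ ht y := Finset.le_sup (f := Finset.card) hV
    rw [Finset.card_insert_of_notMem hy] at this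
    omega
  refine ⟨fun x => ⟨ht x - 1, by have := hpos x; have := hle x; omega⟩, fun x y hxy hlt' => ?_⟩
  have hxy' : ht x = ht y := by
    have := hpos x
    have := hpos y
    simp only [Fin.mk.injEq] at hxy
    omega
  by_contra hge
  have hne : g x ≠ g y := fun h => hlt'.ne (g.injective h)
  have := hlt x y hlt' (lt_of_le_of_ne (not_lt.1 hge) hne.symm)
  omega

/-- Straightening: modulo `J_k`, the group algebra is spanned by the permutations that have no
decreasing subsequence of length `kk + 1`. -/
theorem of_mem_span_avoidsDecreasing_sup_Jk {kk : ℕ} (g : Equiv.Perm (Fin n)) :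
    MonoidAlgebra.of k _ g ∈
      Submodule.span k (MonoidAlgebra.of k _ '' {g | AvoidsDecreasing kk g}) ⊔ Jk k n kk := by
  have wf : WellFounded fun g h : Equiv.Perm (Fin n) => toLex (⇑g) < toLex (⇑h) :=
    InvImage.wf _ wellFounded_lt
  induction g using wf.induction with
  | _ g ih =>
  by_cases hg : AvoidsDecreasing kk g
  · exact Submodule.mem_sup_left (Submodule.subset_span ⟨g, hg, rfl⟩)
  · simp only [AvoidsDecreasing, not_forall, not_not] at hg
    obtain ⟨U, hU, hanti⟩ := hg
    have hJ := mul_mem_Jk (MonoidAlgebra.of k _ g) (antisym_mem_Jk (k := k) hU)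
    rw [antisym, Finset.mul_sum, ← Finset.add_sum_erase _ _ (a := 1) (by simp)] at hJ
    simp only [Units.val_one, Int.cast_one, one_smul, map_one, mul_one] at hJ
    rw [← add_sub_cancel_right (MonoidAlgebra.of k _ g) (∑ w ∈ _, _)]
    refine sub_mem (Submodule.mem_sup_right hJ) (sum_mem fun w hw => ?_)
    simp only [Finset.mem_erase, Finset.mem_filter, Finset.mem_univ, true_and] at hw
    rw [mul_smul_comm, ← map_mul]
    exact Submodule.smul_mem _ _ (ih _ (toLex_mul_lt_of_strictAntiOn hanti hw.2 hw.1))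

/-- Unitriangular systems of linear equations are solvable. -/
theorem exists_solution_of_unitriangular {ι α R M : Type*} [Fintype ι] [Preorder α]
    [WellFoundedLT α] [Ring R] [AddCommGroup M] [Module R M] (s : ι → α) (c : ι → ι → R)
    (hdiag : ∀ i, c i i = 1) (hc : ∀ i j, i ≠ j → c i j ≠ 0 → s i < s j) (x : ι → M) :
    ∃ u : ι → M, ∀ j, ∑ i, c i j • u i = x j := by
  classical
  have wf : WellFounded (InvImage (· < ·) s) := InvImage.wf s wellFounded_lt
  let F : ∀ j, (∀ i, InvImage (· < ·) s i j → M) → M := fun j rec =>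
    x j - ∑ i, if h : s i < s j then c i j • rec i h else 0
  refine ⟨wf.fix F, fun j => ?_⟩
  have hj : wf.fix F j = x j - ∑ i, if s i < s j then c i j • wf.fix F i else 0 := by
    rw [wf.fix_eq]
    simp [F]
  have hsum : ∑ i, (if s i < s j then c i j • wf.fix F i else 0) =
      ∑ i ∈ Finset.univ.erase j, c i j • wf.fix F i := by
    rw [← Finset.add_sum_erase _ _ (Finset.mem_univ j), if_neg (lt_irrefl _), zero_add]
    refine Finset.sum_congr rfl fun i hi => ?_
    split_ifs with h
    · rfl
    · have : c i j = 0 := by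
        by_contra h0
        exact h (hc i j (Finset.ne_of_mem_erase hi) h0)
      rw [this, zero_smul]
  rw [← Finset.add_sum_erase _ _ (Finset.mem_univ j), hdiag, one_smul, hj, hsum, sub_add_cancel]

/-- The coefficient of the identity, as a linear functional. -/
noncomputable def coeffOne (k : Type*) [CommRing k] (G : Type*) [Group G] :
    MonoidAlgebra k G →ₗ[k] k where
  toFun x := x.coeff 1
  map_add' _ _ := rfl
  map_smul' _ _ := rfl

theorem coeffOne_of {G : Type*} [Group G] [DecidableEq G] (g : G) :
    coeffOne k G (MonoidAlgebra.of k G g) = if g = 1 then 1 else 0 := by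
  change (MonoidAlgebra.single g (1 : k)).coeff 1 = _
  rw [MonoidAlgebra.coeff_single, Finsupp.single_apply]

theorem coeffOne_colorSum_mul_of {κ : Type*} [DecidableEq κ] (a b : Fin n → κ)
    (g : Equiv.Perm (Fin n)) :
    coeffOne k _ (colorSum k a b * MonoidAlgebra.of k _ g) =
      if ∀ x, b (g x) = a x then 1 else 0 := by
  rw [colorSum_mul_of, colorSum, map_sum]
  simp only [coeffOne_of]
  rw [Finset.sum_ite_eq']
  simp [eq_comm]

theorem sum_coeffOne_mul_of_smul_of_inv {G : Type*} [Group G] [Fintype G] (x : MonoidAlgebra k G) :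
    ∑ g, coeffOne k G (x * MonoidAlgebra.of k G g) • MonoidAlgebra.of k G g⁻¹ = x := by
  classical
  induction x using MonoidAlgebra.induction_on with
  | of h =>
    rw [Finset.sum_eq_single h⁻¹]
    · rw [← map_mul, coeffOne_of]; simp
    · intro g _ hg
      rw [← map_mul, coeffOne_of, if_neg, zero_smul]
      exact fun h1 => hg (eq_inv_of_mul_eq_one_right h1)
    · simp
  | add x y hx hy => simp only [add_mul, map_add, add_smul, Finset.sum_add_distrib, hx, hy]
  | smul r x hx =>
    simp only [smul_mul_assoc, map_smul, smul_assoc, ← Finset.smul_sum, hx]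

/-- Modulo `J_k`, the identity map of the group algebra factors through functionals represented by
elements of `I_k`. -/
theorem exists_dual_family {kk : ℕ} (h : IsUnit ((n.factorial : ℕ) : k)) :
    ∃ (ι : Type) (_ : Fintype ι) (y u : ι → 𝔸), (∀ i, y i ∈ Ik k n kk) ∧
      ∀ x, x - ∑ i, coeffOne k _ (y i * x) • u i ∈ Jk k n kk := by
  classical
  let ι := {g : Equiv.Perm (Fin n) // AvoidsDecreasing kk g}
  choose a ha using fun g : ι => g.2.exists_coloring
  let y : ι → 𝔸 := fun g => colorSum k (a g) (a g ∘ ⇑(g.1)⁻¹)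
  have hy : ∀ i, y i ∈ Ik k n kk := fun i => colorSum_mem_Ik _ _
  obtain ⟨u, hu⟩ := exists_solution_of_unitriangular (fun g : ι => toLex (⇑g.1))
    (fun i j => coeffOne k _ (y i * MonoidAlgebra.of k _ j.1))
    (fun i => by
      simp only [y, coeffOne_colorSum_mul_of]
      simp)
    (fun i j hij hne => by
      simp only [y, coeffOne_colorSum_mul_of, Function.comp_apply, ne_eq, ite_eq_right_iff,
        not_forall] at hne
      exact toLex_lt_of_strictMono_on_colors (ha i) hne.1 (fun h => hij (Subtype.ext h)))
    (fun j => MonoidAlgebra.of k _ j.1)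
  refine ⟨ι, inferInstance, y, u, hy, fun x => ?_⟩
  let q : 𝔸 →ₗ[k] 𝔸 :=
    LinearMap.id - ∑ i, ((coeffOne k _).comp (LinearMap.mulLeft k (y i))).smulRight (u i)
  have hq : ∀ x, q x = x - ∑ i, coeffOne k _ (y i * x) • u i := fun x => by simp [q]
  rw [← hq]
  suffices hle : (⊤ : Submodule k 𝔸) ≤ (Jk k n kk).comap q from hle trivial
  have hspan : Submodule.span k (MonoidAlgebra.of k _ '' {g | AvoidsDecreasing kk g}) ⊔ Jk k n kk ≤
      (Jk k n kk).comap q := by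
    refine sup_le (Submodule.span_le.2 ?_) fun x hx => ?_
    · rintro _ ⟨g, hg, rfl⟩
      rw [SetLike.mem_coe, Submodule.mem_comap, hq, hu ⟨g, hg⟩, sub_self]
      exact zero_mem _
    · rw [Submodule.mem_comap, hq]
      simpa [Ik_mul_Jk h (hy _) hx] using hx
  intro x _
  induction x using MonoidAlgebra.induction_on with
  | of g => exact hspan (of_mem_span_avoidsDecreasing_sup_Jk g)
  | add x y hx hy => exact add_mem (hx trivial) (hy trivial)
  | smul r x hx => exact Submodule.smul_mem _ r (hx trivial)

theorem exists_Ik_add_Jk_eq_one {kk : ℕ} (h : IsUnit ((n.factorial : ℕ) : k)) :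
    ∃ e ∈ Ik k n kk, ∃ f ∈ Jk k n kk, e + f = 1 := by
  obtain ⟨ι, _, y, u, hy, hJ⟩ := exists_dual_family (n := n) (kk := kk) h
  obtain ⟨r, hr⟩ := h.exists_left_inv
  refine ⟨r • ∑ i, u i * y i, Submodule.smul_mem _ _ (sum_mem fun i _ => mul_mem_Ik _ (hy i)),
    r • ∑ g : Equiv.Perm (Fin n), (MonoidAlgebra.of k _ g -
      ∑ i, coeffOne k _ (y i * MonoidAlgebra.of k _ g) • u i) * MonoidAlgebra.of k _ g⁻¹,
    Submodule.smul_mem _ _ (sum_mem fun g _ => mem_Jk_mul _ (hJ _)), ?_⟩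
  have hsum : ∑ g : Equiv.Perm (Fin n),
      (∑ i, coeffOne k _ (y i * MonoidAlgebra.of k _ g) • u i) * MonoidAlgebra.of k _ g⁻¹ =
      ∑ i, u i * y i := by
    simp only [Finset.sum_mul]
    rw [Finset.sum_comm]
    refine Finset.sum_congr rfl fun i _ => ?_
    conv_rhs => rw [← sum_coeffOne_mul_of_smul_of_inv (y i), Finset.mul_sum]
    simp only [smul_mul_assoc, mul_smul_comm]
  simp only [sub_mul, Finset.sum_sub_distrib, hsum, ← map_mul, mul_inv_cancel, map_one]
  rw [← smul_add, add_sub_cancel, Finset.sum_const, Finset.card_univ, Fintype.card_perm,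
    Fintype.card_fin, ← Nat.cast_smul_eq_nsmul k, smul_smul, hr, one_smul]

end

/-- Theorem: if `n!` is invertible in `k`, then `A = I_k ⊕ J_k` as an internal
direct sum of `k`-modules; the ideals `I_k` and `J_k` (as nonunital subalgebras
of `A`) have two-sided unities; and the map `I_k × J_k → A, (i,j) ↦ i + j`, is
an isomorphism of `k`-algebras (being a `k`-linear bijection that carries the
componentwise product to the product of `A`: mixed products vanish, so
`(i+j)(i'+j') = ii' + jj'` with `ii' ∈ I_k` and `jj' ∈ J_k`). -/
theorem Ik_Jk_direct_sum (k : Type*) [CommRing k] (n kk : ℕ)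
    (h : IsUnit ((n.factorial : ℕ) : k)) :
    Disjoint (Ik k n kk) (Jk k n kk) ∧ Ik k n kk ⊔ Jk k n kk = ⊤ ∧
    (∃ e ∈ Ik k n kk, ∀ x ∈ Ik k n kk, e * x = x ∧ x * e = x) ∧
    (∃ e ∈ Jk k n kk, ∀ x ∈ Jk k n kk, e * x = x ∧ x * e = x) ∧
    Function.Bijective (fun p : Ik k n kk × Jk k n kk =>
      ((p.1 : MonoidAlgebra k (Equiv.Perm (Fin n))) +
        (p.2 : MonoidAlgebra k (Equiv.Perm (Fin n))))) ∧
    (∀ i i' : Ik k n kk, ∀ j j' : Jk k n kk,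
      ((i : MonoidAlgebra k (Equiv.Perm (Fin n))) + j) * ((i' : MonoidAlgebra k (Equiv.Perm (Fin n))) + j')
        = (i : MonoidAlgebra k (Equiv.Perm (Fin n))) * i' +
          (j : MonoidAlgebra k (Equiv.Perm (Fin n))) * j' ∧
      (i : MonoidAlgebra k (Equiv.Perm (Fin n))) * i' ∈ Ik k n kk ∧
      (j : MonoidAlgebra k (Equiv.Perm (Fin n))) * j' ∈ Jk k n kk) := by
  obtain ⟨e, he, f, hf, hef⟩ := exists_Ik_add_Jk_eq_one (n := n) (kk := kk) h
  have hI : ∀ x ∈ Ik k n kk, e * x = x ∧ x * e = x := fun x hx => by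
    constructor
    · conv_rhs => rw [← one_mul x, ← hef, add_mul, Jk_mul_Ik h hx hf, add_zero]
    · conv_rhs => rw [← mul_one x, ← hef, mul_add, Ik_mul_Jk h hx hf, add_zero]
  have hJ : ∀ x ∈ Jk k n kk, f * x = x ∧ x * f = x := fun x hx => by
    constructor
    · conv_rhs => rw [← one_mul x, ← hef, add_mul, Ik_mul_Jk h he hx, zero_add]
    · conv_rhs => rw [← mul_one x, ← hef, mul_add, Jk_mul_Ik h he hx, zero_add]
  have hdisj : Disjoint (Ik k n kk) (Jk k n kk) := by
    rw [Submodule.disjoint_def]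
    intro x hx hx'
    rw [← (hI x hx).1, Ik_mul_Jk h he hx']
  have hsup : Ik k n kk ⊔ Jk k n kk = ⊤ := by
    refine Submodule.eq_top_iff'.2 fun x => ?_
    rw [← one_mul x, ← hef, add_mul]
    exact Submodule.add_mem_sup (mem_Ik_mul x he) (mem_Jk_mul x hf)
  refine ⟨hdisj, hsup, ⟨e, he, hI⟩, ⟨f, hf, hJ⟩,
    (Submodule.prodEquivOfIsCompl _ _ ⟨hdisj, codisjoint_iff.2 hsup⟩).bijective,
    fun i i' j j' => ⟨?_, mem_Ik_mul _ i.2, mem_Jk_mul _ j.2⟩⟩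
  rw [add_mul, mul_add, mul_add, Ik_mul_Jk h i.2 j'.2, Jk_mul_Ik h i'.2 j.2, add_zero, zero_add]
end
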